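/- arXiv:2604.22172 — 4 statements merged into one kernel-verified Lean document; each statement's English description precedes it below -/
import Mathlib

section
/- Let j ∈ {1,3}, let R₁(α) and R₃(α) denote the standard 3×3 rotation matrices about the first and third coordinate axes, and let e_j* denote the j-th standard basis vector of ℝ³. Let α : ℝ → ℝ and ξ, ζ : ℝ → ℝ³ be differentiable, and define x(t) = R_j(α(t)) ξ(t) and y(t) = R_j(α(t)) ζ(t). Then for every t one has y(t)·x'(t) = ((x(t) × y(t))·e_j*) α'(t) + ζ(t)·ξ'(t). -/
open Matrix

/-- Rotation matrix about the first coordinate axis. -/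
noncomputable def R1 (α : ℝ) : Matrix (Fin 3) (Fin 3) ℝ :=
  !![1, 0, 0; 0, Real.cos α, -Real.sin α; 0, Real.sin α, Real.cos α]

/-- Rotation matrix about the third coordinate axis. -/
noncomputable def R3 (α : ℝ) : Matrix (Fin 3) (Fin 3) ℝ :=
  !![Real.cos α, -Real.sin α, 0; Real.sin α, Real.cos α, 0; 0, 0, 1]

/-- First standard basis vector of ℝ³. -/
def e1 : Fin 3 → ℝ := ![1, 0, 0]

/-- Third standard basis vector of ℝ³. -/
def e3 : Fin 3 → ℝ := ![0, 0, 1]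

theorem R1_mulVec (a : ℝ) (v : Fin 3 → ℝ) :
    R1 a *ᵥ v = ![v 0, Real.cos a * v 1 - Real.sin a * v 2,
      Real.sin a * v 1 + Real.cos a * v 2] := by
  ext i
  fin_cases i <;> simp [R1, mulVec, dotProduct, Fin.sum_univ_three, sub_eq_add_neg]

theorem R3_mulVec (a : ℝ) (v : Fin 3 → ℝ) :
    R3 a *ᵥ v = ![Real.cos a * v 0 - Real.sin a * v 1,
      Real.sin a * v 0 + Real.cos a * v 1, v 2] := by
  ext i
  fin_cases i <;> simp [R3, mulVec, dotProduct, Fin.sum_univ_three, sub_eq_add_neg]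

theorem hasDerivAt_cos_mul_sub_sin_mul {a f g : ℝ → ℝ} {a' f' g' t : ℝ}
    (ha : HasDerivAt a a' t) (hf : HasDerivAt f f' t) (hg : HasDerivAt g g' t) :
    HasDerivAt (fun s => Real.cos (a s) * f s - Real.sin (a s) * g s)
      (Real.cos (a t) * f' - Real.sin (a t) * g'
        - (Real.sin (a t) * f t + Real.cos (a t) * g t) * a') t := by
  refine ((ha.cos.mul hf).sub (ha.sin.mul hg)).congr_deriv ?_
  ring

theorem hasDerivAt_sin_mul_add_cos_mul {a f g : ℝ → ℝ} {a' f' g' t : ℝ}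
    (ha : HasDerivAt a a' t) (hf : HasDerivAt f f' t) (hg : HasDerivAt g g' t) :
    HasDerivAt (fun s => Real.sin (a s) * f s + Real.cos (a s) * g s)
      (Real.sin (a t) * f' + Real.cos (a t) * g'
        + (Real.cos (a t) * f t - Real.sin (a t) * g t) * a') t := by
  refine ((ha.sin.mul hf).add (ha.cos.mul hg)).congr_deriv ?_
  ring

theorem deriv_R1_mulVec {a : ℝ → ℝ} {v : ℝ → Fin 3 → ℝ} {t : ℝ}
    (ha : DifferentiableAt ℝ a t) (hv : DifferentiableAt ℝ v t) :
    deriv (fun s => R1 (a s) *ᵥ v s) t =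
      R1 (a t) *ᵥ deriv v t + deriv a t • crossProduct e1 (R1 (a t) *ᵥ v t) := by
  have hc := hasDerivAt_pi.1 hv.hasDerivAt
  refine HasDerivAt.deriv (hasDerivAt_pi.2 fun i => ?_)
  simp only [R1_mulVec]
  fin_cases i
  · simpa [e1, cross_apply] using hc 0
  · refine (hasDerivAt_cos_mul_sub_sin_mul ha.hasDerivAt (hc 1) (hc 2)).congr_deriv ?_
    simp [e1, cross_apply]
    ring
  · refine (hasDerivAt_sin_mul_add_cos_mul ha.hasDerivAt (hc 1) (hc 2)).congr_deriv ?_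
    simp [e1, cross_apply]
    ring

theorem deriv_R3_mulVec {a : ℝ → ℝ} {v : ℝ → Fin 3 → ℝ} {t : ℝ}
    (ha : DifferentiableAt ℝ a t) (hv : DifferentiableAt ℝ v t) :
    deriv (fun s => R3 (a s) *ᵥ v s) t =
      R3 (a t) *ᵥ deriv v t + deriv a t • crossProduct e3 (R3 (a t) *ᵥ v t) := by
  have hc := hasDerivAt_pi.1 hv.hasDerivAt
  refine HasDerivAt.deriv (hasDerivAt_pi.2 fun i => ?_)
  simp only [R3_mulVec]
  fin_cases i
  · refine (hasDerivAt_cos_mul_sub_sin_mul ha.hasDerivAt (hc 0) (hc 1)).congr_deriv ?_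
    simp [e3, cross_apply]
    ring
  · refine (hasDerivAt_sin_mul_add_cos_mul ha.hasDerivAt (hc 0) (hc 1)).congr_deriv ?_
    simp [e3, cross_apply]
    ring
  · simpa [e3, cross_apply] using hc 2

theorem R1_mulVec_dotProduct (a : ℝ) (v w : Fin 3 → ℝ) :
    (R1 a *ᵥ v) ⬝ᵥ (R1 a *ᵥ w) = v ⬝ᵥ w := by
  simp only [R1_mulVec, dotProduct, Fin.sum_univ_three, cons_val]
  linear_combination (v 1 * w 1 + v 2 * w 2) * Real.sin_sq_add_cos_sq a

theorem R3_mulVec_dotProduct (a : ℝ) (v w : Fin 3 → ℝ) :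
    (R3 a *ᵥ v) ⬝ᵥ (R3 a *ᵥ w) = v ⬝ᵥ w := by
  simp only [R3_mulVec, dotProduct, Fin.sum_univ_three, cons_val]
  linear_combination (v 0 * w 0 + v 1 * w 1) * Real.sin_sq_add_cos_sq a

theorem stmt0 (R : ℝ → Matrix (Fin 3) (Fin 3) ℝ) (e : Fin 3 → ℝ)
    (hRe : (R = R1 ∧ e = e1) ∨ (R = R3 ∧ e = e3))
    (α : ℝ → ℝ) (ξ ζ : ℝ → Fin 3 → ℝ)
    (hα : Differentiable ℝ α) (hξ : Differentiable ℝ ξ) (hζ : Differentiable ℝ ζ)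
    (x y : ℝ → Fin 3 → ℝ)
    (hx : ∀ t, x t = (R (α t)).mulVec (ξ t))
    (hy : ∀ t, y t = (R (α t)).mulVec (ζ t)) :
    ∀ t, y t ⬝ᵥ deriv x t =
      ((crossProduct (x t) (y t)) ⬝ᵥ e) * deriv α t + ζ t ⬝ᵥ deriv ξ t := by
  intro t
  have triple : y t ⬝ᵥ crossProduct e (x t) = crossProduct (x t) (y t) ⬝ᵥ e := by
    rw [triple_product_permutation, dotProduct_comm]
  rw [← triple]
  obtain rfl : x = fun t => R (α t) *ᵥ ξ t := funext hx
  obtain rfl : y = fun t => R (α t) *ᵥ ζ t := funext hy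
  rcases hRe with ⟨rfl, rfl⟩ | ⟨rfl, rfl⟩
  · rw [deriv_R1_mulVec (hα t) (hξ t), dotProduct_add, dotProduct_smul,
      R1_mulVec_dotProduct, smul_eq_mul]
    ring
  · rw [deriv_R3_mulVec (hα t) (hξ t), dotProduct_add, dotProduct_smul,
      R3_mulVec_dotProduct, smul_eq_mul]
    ring
end

section
/- Let m ≥ 1, let A and B be real symmetric m×m matrices with A positive definite and B invertible, and let r ∈ ℝ with r ≠ 0. Then every complex eigenvalue of the 2m×2m block matrix M = [[−(r/2)·I_m, B],[A, 0]] has nonzero real part. -/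
open Matrix

open scoped ComplexOrder MatrixOrder in
/-- The complexification of a real positive definite matrix is positive definite. -/
theorem Matrix.PosDef.map_ofReal {n : Type*} [Fintype n] {A : Matrix n n ℝ} (hA : A.PosDef) :
    (A.map (Complex.ofReal ·)).PosDef := by
  classical
  obtain ⟨C, hC, rfl⟩ : ∃ C : Matrix n n ℝ, IsUnit C ∧ A = Cᴴ * C :=
    CStarAlgebra.isStrictlyPositive_iff_eq_star_mul_self.mp
      (Matrix.isStrictlyPositive_iff_posDef.mpr hA)
  have hCu : IsUnit (C.map (Complex.ofReal ·)) :=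
    hC.map (Complex.ofRealHom.mapMatrix : Matrix n n ℝ →+* Matrix n n ℂ)
  have h : (Cᴴ * C).map (Complex.ofReal ·) =
      (C.map (Complex.ofReal ·))ᴴ * C.map (Complex.ofReal ·) := by
    ext i j
    simp [Matrix.mul_apply]
  rw [h]
  exact Matrix.PosDef.conjTranspose_mul_self _ (Matrix.mulVec_injective_of_isUnit hCu)

open scoped ComplexOrder in
theorem stmt9 (m : ℕ) (hm : 1 ≤ m) (A B : Matrix (Fin m) (Fin m) ℝ)
    (hAsymm : A.IsSymm) (hApos : A.PosDef) (hBsymm : B.IsSymm)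
    (hBinv : IsUnit B.det)
    (r : ℝ) (hr : r ≠ 0)
    (M : Matrix (Fin m ⊕ Fin m) (Fin m ⊕ Fin m) ℝ)
    (hM : M = Matrix.fromBlocks (-(r / 2) • (1 : Matrix (Fin m) (Fin m) ℝ)) B A 0) :
    ∀ μ ∈ spectrum ℂ (M.map (Complex.ofReal ·)), μ.re ≠ 0 := by
  intro μ hμ hre
  have hA' : (A.map (Complex.ofReal ·)).PosDef := hApos.map_ofReal
  have hB' : (B.map (Complex.ofReal ·)).IsHermitian := by
    ext i j
    simp [hBsymm.apply i j]
  have hBu : IsUnit (B.map (Complex.ofReal ·)) := by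
    exact ((Matrix.isUnit_iff_isUnit_det B).mpr hBinv).map
      (Complex.ofRealHom.mapMatrix : Matrix (Fin m) (Fin m) ℝ →+* Matrix (Fin m) (Fin m) ℂ)
  have hMc : M.map (Complex.ofReal ·) = Matrix.fromBlocks
      (-(r / 2 : ℂ) • (1 : Matrix (Fin m) (Fin m) ℂ)) (B.map (Complex.ofReal ·))
      (A.map (Complex.ofReal ·)) 0 := by
    rw [hM, Matrix.fromBlocks_map]
    congr 1
    · ext i j
      by_cases h : i = j <;> simp [h]
  rw [hMc, ← Matrix.spectrum_toLin', ← Module.End.hasEigenvalue_iff_mem_spectrum] at hμ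
  obtain ⟨v, hv⟩ := hμ.exists_hasEigenvector
  have hv0 := hv.2
  have hve := hv.apply_eq_smul
  generalize A.map (Complex.ofReal ·) = A' at *
  generalize B.map (Complex.ofReal ·) = B' at *
  obtain ⟨x, y, rfl⟩ : ∃ x y, v = Sum.elim x y :=
    ⟨v ∘ Sum.inl, v ∘ Sum.inr, (Sum.elim_comp_inl_inr v).symm⟩
  rw [Matrix.toLin'_apply, Matrix.fromBlocks_mulVec] at hve
  have h₁ : B' *ᵥ y = (μ + r / 2) • x := by
    ext i
    have := congrFun hve (Sum.inl i)
    simp [Matrix.neg_mulVec, Matrix.smul_mulVec] at this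
    simp
    linear_combination this
  have h₂ : A' *ᵥ x = μ • y := by
    ext i
    simpa using congrFun hve (Sum.inr i)
  have hx : x = 0 := by
    by_contra hx
    have ha := hA'.dotProduct_mulVec_pos hx
    have hb : star (star y ⬝ᵥ (B' *ᵥ y)) = star y ⬝ᵥ (B' *ᵥ y) := by
      rw [← Matrix.star_dotProduct_star, star_star, Matrix.star_mulVec, hB'.eq,
        Matrix.dotProduct_mulVec]
    have hs : star (star x ⬝ᵥ y) = star y ⬝ᵥ x := by
      rw [← Matrix.star_dotProduct_star, star_star]
    rw [h₁, dotProduct_smul, ← hs] at hb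
    rw [h₂, dotProduct_smul] at ha
    generalize star x ⬝ᵥ y = c at *
    rw [Complex.pos_iff] at ha
    have him := congrArg Complex.im hb
    simp [hre] at ha him
    have hcr : μ.im * c.re = 0 := mul_eq_zero.mpr ha.2
    apply mul_ne_zero hr ha.1.ne
    linear_combination μ.im * him + 2 * μ.im * hcr
  subst hx
  have hy : y = 0 := by
    apply Matrix.mulVec_injective_of_isUnit hBu
    simpa using h₁
  subst hy
  exact hv0 (by ext (i | i) <;> rfl)
end

section
/- Let m ≥ 1, let A and B be real symmetric m×m matrices with A positive definite, and let r ∈ ℝ with r ≠ 0. Let M = [[−(r/2)·I_m, B],[A, 0]] be the corresponding 2m×2m block matrix. Then: (a) every complex eigenvalue of M with zero real part is equal to 0; (b) the kernel of M equals {(w,s) ∈ ℝ^m × ℝ^m : w = 0 and Bs = 0}; and (c) the generalized eigenspace of M for the eigenvalue 0 coincides with the kernel of M, i.e. ker(M²) = ker(M). -/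
open Matrix

/-- A vector annihilated by the quadratic form of a positive definite real matrix is zero. -/
theorem Matrix.PosDef.eq_zero_of_dotProduct_mulVec_nonpos {n : Type*} [Fintype n]
    {A : Matrix n n ℝ} (hA : A.PosDef) {x : n → ℝ} (h : x ⬝ᵥ A *ᵥ x ≤ 0) : x = 0 := by
  by_contra hx
  have := hA.dotProduct_mulVec_pos hx
  rw [star_trivial] at this
  linarith

theorem Matrix.IsSymm.dotProduct_mulVec_comm {n R : Type*} [Fintype n] [CommSemiring R]
    {A : Matrix n n R} (hA : A.IsSymm) (x y : n → R) : x ⬝ᵥ A *ᵥ y = y ⬝ᵥ A *ᵥ x := by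
  rw [dotProduct_mulVec, ← mulVec_transpose, hA.eq, dotProduct_comm]

/-- The real and imaginary parts of an eigenvector `(x + i y, p + i q)` for a nonzero purely
imaginary eigenvalue `i β` vanish in the first component. -/
theorem eq_zero_of_imaginary_eigenvector {n : Type*} [Fintype n] {A B : Matrix n n ℝ}
    (hA : A.IsSymm) (hApos : A.PosDef) (hB : B.IsSymm) {c β : ℝ} (hc : c ≠ 0)
    {x y p q : n → ℝ} (hBp : B *ᵥ p = c • x - β • y) (hBq : B *ᵥ q = c • y + β • x)
    (hAx : A *ᵥ x = -β • q) (hAy : A *ᵥ y = β • p) : x = 0 ∧ y = 0 := by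
  have e₁ := hB.dotProduct_mulVec_comm p q
  have e₂ := hA.dotProduct_mulVec_comm x y
  have nx : 0 ≤ x ⬝ᵥ A *ᵥ x := by simpa using hApos.posSemidef.dotProduct_mulVec_nonneg x
  have ny : 0 ≤ y ⬝ᵥ A *ᵥ y := by simpa using hApos.posSemidef.dotProduct_mulVec_nonneg y
  have key : c * (x ⬝ᵥ A *ᵥ x + y ⬝ᵥ A *ᵥ y) = 0 := by
    rw [hBp, hBq] at e₁
    rw [hAx, hAy] at e₂ ⊢
    simp only [dotProduct_add, dotProduct_sub, dotProduct_smul, smul_eq_mul] at e₁ e₂ ⊢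
    rw [dotProduct_comm p x, dotProduct_comm p y, dotProduct_comm q x, dotProduct_comm q y] at e₁
    linear_combination β * e₁ - β * e₂
  have hsum := (mul_eq_zero.mp key).resolve_left hc
  exact ⟨hApos.eq_zero_of_dotProduct_mulVec_nonpos (by linarith),
    hApos.eq_zero_of_dotProduct_mulVec_nonpos (by linarith)⟩

theorem Matrix.re_map_ofReal_mulVec {m n : Type*} [Fintype n] (M : Matrix m n ℝ) (v : n → ℂ)
    (i : m) : (((M.map (Complex.ofReal ·)) *ᵥ v) i).re = (M *ᵥ fun j => (v j).re) i := by
  simp [mulVec, dotProduct]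

theorem Matrix.im_map_ofReal_mulVec {m n : Type*} [Fintype n] (M : Matrix m n ℝ) (v : n → ℂ)
    (i : m) : (((M.map (Complex.ofReal ·)) *ᵥ v) i).im = (M *ᵥ fun j => (v j).im) i := by
  simp [mulVec, dotProduct]

theorem fromBlocks_smul_one_mulVec {n : Type*} [Fintype n] [DecidableEq n]
    (A B : Matrix n n ℝ) (c : ℝ) (v : n ⊕ n → ℝ) :
    fromBlocks (-c • (1 : Matrix n n ℝ)) B A 0 *ᵥ v =
      Sum.elim (-c • (v ∘ Sum.inl) + B *ᵥ (v ∘ Sum.inr)) (A *ᵥ (v ∘ Sum.inl)) := by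
  rw [fromBlocks_mulVec, smul_mulVec, one_mulVec, zero_mulVec, add_zero]

theorem fromBlocks_smul_one_mulVec_eq_zero_iff {n : Type*} [Fintype n] [DecidableEq n]
    {A : Matrix n n ℝ} (hA : A.PosDef) (B : Matrix n n ℝ) (c : ℝ) (v : n ⊕ n → ℝ) :
    fromBlocks (-c • (1 : Matrix n n ℝ)) B A 0 *ᵥ v = 0 ↔
      v ∘ Sum.inl = 0 ∧ B *ᵥ (v ∘ Sum.inr) = 0 := by
  rw [fromBlocks_smul_one_mulVec]
  constructor
  · intro h
    have h₁ : -c • (v ∘ Sum.inl) + B *ᵥ (v ∘ Sum.inr) = 0 :=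
      funext fun i => congrFun h (Sum.inl i)
    have h₂ : A *ᵥ (v ∘ Sum.inl) = 0 := funext fun i => congrFun h (Sum.inr i)
    have hw : v ∘ Sum.inl = 0 := hA.eq_zero_of_dotProduct_mulVec_nonpos (by simp [h₂])
    exact ⟨hw, by simpa [hw] using h₁⟩
  · rintro ⟨h₁, h₂⟩
    rw [h₁, h₂]
    ext (i | i) <;> simp

theorem fromBlocks_smul_one_mul_self_mulVec_eq_zero_iff {n : Type*} [Fintype n] [DecidableEq n]
    {A B : Matrix n n ℝ} (hA : A.PosDef) (hB : B.IsSymm) {c : ℝ} (hc : c ≠ 0) {v : n ⊕ n → ℝ} :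
    (fromBlocks (-c • (1 : Matrix n n ℝ)) B A 0 * fromBlocks (-c • (1 : Matrix n n ℝ)) B A 0) *ᵥ v
        = 0 ↔ fromBlocks (-c • (1 : Matrix n n ℝ)) B A 0 *ᵥ v = 0 := by
  rw [← mulVec_mulVec]
  refine ⟨fun h => ?_, fun h => by rw [h, mulVec_zero]⟩
  rw [fromBlocks_smul_one_mulVec_eq_zero_iff hA, fromBlocks_smul_one_mulVec, Sum.elim_comp_inl,
    Sum.elim_comp_inr] at h
  obtain ⟨h₁, h₂⟩ := h
  have hBs : B *ᵥ (v ∘ Sum.inr) = c • (v ∘ Sum.inl) := by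
    rw [neg_smul, neg_add_eq_zero] at h₁
    exact h₁.symm
  have hw : v ∘ Sum.inl = 0 := by
    refine hA.eq_zero_of_dotProduct_mulVec_nonpos (le_of_eq ?_)
    have := hB.dotProduct_mulVec_comm (v ∘ Sum.inr) (A *ᵥ (v ∘ Sum.inl))
    rw [h₂, hBs, dotProduct_zero, dotProduct_smul, smul_eq_mul, dotProduct_comm] at this
    exact (mul_eq_zero.mp this.symm).resolve_left hc
  rw [fromBlocks_smul_one_mulVec_eq_zero_iff hA]
  exact ⟨hw, by rw [hBs, hw, smul_zero]⟩

theorem eq_zero_of_mem_spectrum_fromBlocks_smul_one {n : Type*} [Fintype n] [DecidableEq n]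
    {A B : Matrix n n ℝ} (hA : A.IsSymm) (hApos : A.PosDef) (hB : B.IsSymm) {c : ℝ} (hc : c ≠ 0)
    {μ : ℂ} (hμ : μ ∈ spectrum ℂ
      ((fromBlocks (-c • (1 : Matrix n n ℝ)) B A 0).map (Complex.ofReal ·)))
    (hre : μ.re = 0) : μ = 0 := by
  by_contra hne
  have him : μ.im ≠ 0 := fun h => hne (Complex.ext hre h)
  rw [← spectrum_toLin'] at hμ
  obtain ⟨v, hv⟩ := (Module.End.HasEigenvalue.of_mem_spectrum hμ).exists_hasEigenvector
  have hMv := hv.apply_eq_smul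
  rw [toLin'_apply] at hMv
  have hR : ∀ i, (fromBlocks (-c • (1 : Matrix n n ℝ)) B A 0 *ᵥ fun j => (v j).re) i =
      -μ.im * (v i).im := fun i => by
    rw [← re_map_ofReal_mulVec, hMv]
    simp [hre]
  have hI : ∀ i, (fromBlocks (-c • (1 : Matrix n n ℝ)) B A 0 *ᵥ fun j => (v j).im) i =
      μ.im * (v i).re := fun i => by
    rw [← im_map_ofReal_mulVec, hMv]
    simp [hre]
  rw [fromBlocks_smul_one_mulVec] at hR hI
  have hAx : A *ᵥ ((fun j => (v j).re) ∘ Sum.inl) = -μ.im • ((fun j => (v j).im) ∘ Sum.inr) :=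
    funext fun i => hR (Sum.inr i)
  have hAy : A *ᵥ ((fun j => (v j).im) ∘ Sum.inl) = μ.im • ((fun j => (v j).re) ∘ Sum.inr) :=
    funext fun i => hI (Sum.inr i)
  obtain ⟨hx, hy⟩ := eq_zero_of_imaginary_eigenvector hA hApos hB hc
    (funext fun i => by
      have := hR (Sum.inl i)
      simp only [Sum.elim_inl, Pi.add_apply, Pi.sub_apply, Pi.smul_apply, smul_eq_mul,
        Function.comp_apply] at this ⊢
      linarith)
    (funext fun i => by
      have := hI (Sum.inl i)
      simp only [Sum.elim_inl, Pi.add_apply, Pi.smul_apply, smul_eq_mul,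
        Function.comp_apply] at this ⊢
      linarith) hAx hAy
  rw [hx, mulVec_zero, eq_comm, smul_eq_zero_iff_right (neg_ne_zero.mpr him)] at hAx
  rw [hy, mulVec_zero, eq_comm, smul_eq_zero_iff_right him] at hAy
  refine hv.2 (funext ?_)
  rintro (i | i)
  · exact Complex.ext (congrFun hx i) (congrFun hy i)
  · exact Complex.ext (congrFun hAy i) (congrFun hAx i)

theorem stmt10 (m : ℕ) (hm : 1 ≤ m) (A B : Matrix (Fin m) (Fin m) ℝ)
    (hAsymm : A.IsSymm) (hApos : A.PosDef) (hBsymm : B.IsSymm)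
    (r : ℝ) (hr : r ≠ 0)
    (M : Matrix (Fin m ⊕ Fin m) (Fin m ⊕ Fin m) ℝ)
    (hM : M = Matrix.fromBlocks (-(r / 2) • (1 : Matrix (Fin m) (Fin m) ℝ)) B A 0) :
    -- (a) every purely imaginary complex eigenvalue of M is 0
    (∀ μ ∈ spectrum ℂ (M.map (Complex.ofReal ·)), μ.re = 0 → μ = 0)
    -- (b) the kernel of M is {(w, s) : w = 0 and B s = 0}
    ∧ (∀ v : Fin m ⊕ Fin m → ℝ,
        M.mulVec v = 0 ↔
          ((fun i => v (Sum.inl i)) = (0 : Fin m → ℝ)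
            ∧ B.mulVec (fun i => v (Sum.inr i)) = 0))
    -- (c) the generalized 0-eigenspace of M coincides with its kernel
    ∧ (∀ v : Fin m ⊕ Fin m → ℝ, (M * M).mulVec v = 0 ↔ M.mulVec v = 0) := by
  subst hM
  have hc : r / 2 ≠ 0 := div_ne_zero hr two_ne_zero
  exact ⟨fun μ hμ => eq_zero_of_mem_spectrum_fromBlocks_smul_one hAsymm hApos hBsymm hc hμ,
    fromBlocks_smul_one_mulVec_eq_zero_iff hApos B (r / 2),
    fun v => fromBlocks_smul_one_mul_self_mulVec_eq_zero_iff hApos hBsymm hc⟩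
end

section
/- Let m ≥ 1 and 1 ≤ k ≤ m. Let A : ℝ^m → (symmetric positive definite m×m real matrices) be continuously differentiable, let V : ℝ^m → ℝ be twice continuously differentiable with V(0) > 0 and ∇V(0) = 0. Let U ⊂ ℝ^k be a neighborhood of 0 and let Φ : U → ℝ^m and f : U → ℝ^{m−k} be continuously differentiable with f(0) = 0, Φ(0) = 0, Df(0) = 0, DΦ(0) = 0. Set g(x) = (x, f(x)) ∈ ℝ^m, write A(g(x))Φ(x) = (φ(x), ψ(x)) with φ(x) ∈ ℝ^k and ψ(x) ∈ ℝ^{m−k}, and suppose that on U the identities Df(x)φ(x) = ψ(x) and DΦ(x)φ(x) = −½ (Φ(x)·∂_s A(g(x)) Φ(x)) + ∇V(g(x)) + (Φ(x)/2)·√(2V(g(x)) − Φ(x)·A(g(x))Φ(x)) hold, the expression under the square root being positive. Then there exist a neighborhood U' ⊂ U of 0 and constants 0 < k₁ < k₂ such that k₁ |φ(x)| ≤ |∇V(g(x))| ≤ k₂ |φ(x)| for all x ∈ U'. -/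
open Matrix

open Asymptotics Filter Topology in
lemma isBigO_mulVec {α m n : Type*} [Fintype m] [Fintype n] {F : Filter α}
    {M : α → Matrix m n ℝ} {M₀ : Matrix m n ℝ} (hM : Tendsto M F (𝓝 M₀)) (v : α → n → ℝ) :
    (fun x => M x *ᵥ v x) =O[F] v := by
  refine isBigO_pi.2 fun i => ?_
  have h : ∀ j ∈ Finset.univ, (fun x => M x i j * v x j) =O[F] v := fun j _ => by
    have h₁ : (fun x => M x i j) =O[F] (fun _ => (1 : ℝ)) :=
      (((continuous_apply_apply i j).tendsto M₀).comp hM).isBigO_one ℝ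
    have h₂ : (fun x => v x j) =O[F] fun x => ‖v x‖ :=
      IsBigO.of_bound 1 (Eventually.of_forall fun x => by simpa using norm_le_pi_norm (v x) j)
    simpa using (h₁.mul h₂)
  exact IsBigO.fun_sum h

open Asymptotics Filter Topology in
lemma isLittleO_dotProduct_mulVec {α n : Type*} [Fintype n] {F : Filter α}
    {M : α → Matrix n n ℝ} {M₀ : Matrix n n ℝ} (hM : Tendsto M F (𝓝 M₀)) {v : α → n → ℝ}
    (hv : Tendsto v F (𝓝 0)) :
    (fun x => v x ⬝ᵥ M x *ᵥ v x) =o[F] v := by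
  have h : ∀ j ∈ Finset.univ, (fun x => v x j * (M x *ᵥ v x) j) =o[F] v := fun j _ => by
    have h₁ : (fun x => v x j) =o[F] (fun _ => (1 : ℝ)) :=
      (isLittleO_one_iff ℝ).2 (((continuous_apply j).tendsto (0 : n → ℝ)).comp hv)
    have h₂ : (fun x => (M x *ᵥ v x) j) =O[F] fun x => ‖v x‖ :=
      (isBigO_pi.1 (isBigO_mulVec hM v) j).norm_right
    simpa using (h₁.mul_isBigO h₂)
  exact IsLittleO.fun_sum h

open Asymptotics Filter Topology in
lemma isLittleO_clm_apply {α E E' : Type*} [NormedAddCommGroup E] [NormedSpace ℝ E]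
    [NormedAddCommGroup E'] [NormedSpace ℝ E'] {F : Filter α} {L : α → E →L[ℝ] E'}
    (hL : Tendsto L F (𝓝 0)) (v : α → E) : (fun x => L x (v x)) =o[F] v := by
  have h₁ : (fun x => L x (v x)) =O[F] fun x => ‖L x‖ * ‖v x‖ :=
    IsBigO.of_bound 1 (Eventually.of_forall fun x => by simpa using (L x).le_opNorm (v x))
  have h₂ : (fun x => ‖L x‖ * ‖v x‖) =o[F] fun x => (1 : ℝ) * ‖v x‖ :=
    ((isLittleO_one_iff ℝ).2 (by simpa using hL.norm)).mul_isBigO (isBigO_refl _ _)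
  exact h₁.trans_isLittleO (by simpa using h₂)

open Asymptotics Filter Topology in
theorem stmt11 (k l : ℕ) (hk : 1 ≤ k)
    -- the ambient dimension is m = k + l, indexed by Fin k ⊕ Fin l
    (A : ((Fin k ⊕ Fin l) → ℝ) → Matrix (Fin k ⊕ Fin l) (Fin k ⊕ Fin l) ℝ)
    (hAsymm : ∀ s, (A s).IsSymm) (hApos : ∀ s, (A s).PosDef)
    (hAc1 : ∀ a b, ContDiff ℝ 1 (fun s => A s a b))
    (V : ((Fin k ⊕ Fin l) → ℝ) → ℝ) (hV : ContDiff ℝ 2 V)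
    (hV0 : 0 < V 0)
    (gradV : ((Fin k ⊕ Fin l) → ℝ) → (Fin k ⊕ Fin l) → ℝ)
    (hgradV : ∀ s v, fderiv ℝ V s v = gradV s ⬝ᵥ v)
    (hgradV0 : gradV 0 = 0)
    (U : Set (Fin k → ℝ)) (hU : U ∈ nhds (0 : Fin k → ℝ))
    (Φ : (Fin k → ℝ) → (Fin k ⊕ Fin l) → ℝ) (f : (Fin k → ℝ) → Fin l → ℝ)
    (hΦ : ContDiffOn ℝ 1 Φ U) (hf : ContDiffOn ℝ 1 f U)
    (hf0 : f 0 = 0) (hΦ0 : Φ 0 = 0)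
    (hDf0 : fderiv ℝ f 0 = 0) (hDΦ0 : fderiv ℝ Φ 0 = 0)
    (g : (Fin k → ℝ) → (Fin k ⊕ Fin l) → ℝ)
    (hg : ∀ x, g x = Sum.elim x (f x))
    (φ : (Fin k → ℝ) → Fin k → ℝ)
    (hφ : ∀ x i, φ x i = (A (g x)).mulVec (Φ x) (Sum.inl i))
    (ψ : (Fin k → ℝ) → Fin l → ℝ)
    (hψ : ∀ x i, ψ x i = (A (g x)).mulVec (Φ x) (Sum.inr i))
    (hroot : ∀ x ∈ U, 0 < 2 * V (g x) - Φ x ⬝ᵥ (A (g x)).mulVec (Φ x))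
    (hid1 : ∀ x ∈ U, fderiv ℝ f x (φ x) = ψ x)
    (hid2 : ∀ x ∈ U, fderiv ℝ Φ x (φ x) = fun i =>
        -(1 / 2) * (Φ x ⬝ᵥ
          (Matrix.of fun a b =>
            fderiv ℝ (fun s => A s a b) (g x) (Pi.single i 1)).mulVec (Φ x))
      + gradV (g x) i
      + (Φ x i / 2)
          * Real.sqrt (2 * V (g x) - Φ x ⬝ᵥ (A (g x)).mulVec (Φ x))) :
    ∃ U' ∈ nhds (0 : Fin k → ℝ), U' ⊆ U ∧ ∃ k₁ k₂ : ℝ, 0 < k₁ ∧ k₁ < k₂ ∧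
      ∀ x ∈ U', k₁ * ‖φ x‖ ≤ ‖gradV (g x)‖ ∧ ‖gradV (g x)‖ ≤ k₂ * ‖φ x‖ := by
  have hgc : Tendsto g (𝓝 0) (𝓝 0) := by
    have h0 : g 0 = 0 := by
      ext i; rcases i with i | i <;> simp [hg, hf0]
    have : ContinuousAt g 0 := by
      refine continuousAt_pi.2 fun i => ?_
      rcases i with i | i
      · simpa [hg] using (continuous_apply i).continuousAt
      · simpa [hg] using continuousAt_pi.1 (hf.contDiffAt hU).continuousAt i
    simpa [ContinuousAt, h0] using this
  have hΦc : Tendsto Φ (𝓝 0) (𝓝 0) := by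
    simpa [ContinuousAt, hΦ0] using (hΦ.contDiffAt hU).continuousAt
  have hAcont : Continuous A := continuous_matrix fun a b => (hAc1 a b).continuous
  have hA : Tendsto (fun x => A (g x)) (𝓝 0) (𝓝 (A 0)) := (hAcont.tendsto 0).comp hgc
  have hunit : ∀ s, IsUnit (A s).det := fun s => (hApos s).det_pos.ne'.isUnit
  have hAinv : Tendsto (fun x => (A (g x))⁻¹) (𝓝 0) (𝓝 (A 0)⁻¹) := by
    have h : Continuous fun s => (A s)⁻¹ := by
      simp_rw [Matrix.inv_def, Ring.inverse_eq_inv']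
      exact (hAcont.matrix_det.inv₀ fun s => (hApos s).det_pos.ne').smul hAcont.matrix_adjugate
    exact (h.tendsto 0).comp hgc
  have hDf : Tendsto (fderiv ℝ f) (𝓝 0) (𝓝 0) :=
    hDf0 ▸ (hf.contDiffAt hU).continuousAt_fderiv one_ne_zero
  have hDΦ : Tendsto (fderiv ℝ Φ) (𝓝 0) (𝓝 0) :=
    hDΦ0 ▸ (hΦ.contDiffAt hU).continuousAt_fderiv one_ne_zero
  have hφΦ : φ =O[𝓝 0] Φ := by
    refine isBigO_pi.2 fun i => ?_
    simpa only [hφ] using isBigO_pi.1 (isBigO_mulVec hA Φ) (Sum.inl i)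
  have hΦφ : Φ =O[𝓝 0] φ := by
    have h₁ : ψ =O[𝓝 0] φ :=
      (isLittleO_clm_apply hDf φ).isBigO.congr' (eventually_of_mem hU hid1) EventuallyEq.rfl
    have h₂ : (fun x => A (g x) *ᵥ Φ x) =O[𝓝 0] φ := by
      refine isBigO_pi.2 fun i => ?_
      rcases i with i | i
      · simpa only [hφ] using isBigO_pi.1 (isBigO_refl φ (𝓝 0)) i
      · simpa only [hψ] using isBigO_pi.1 h₁ i
    refine ((isBigO_mulVec hAinv fun x => A (g x) *ᵥ Φ x).trans h₂).congr_left fun x => ?_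
    simp [Matrix.mulVec_mulVec, Matrix.nonsing_inv_mul _ (hunit (g x))]
  have hroot_tendsto : Tendsto
      (fun x => Real.sqrt (2 * V (g x) - Φ x ⬝ᵥ (A (g x)).mulVec (Φ x)) - Real.sqrt (2 * V 0))
      (𝓝 0) (𝓝 0) := by
    have h₁ := ((hV.continuous.tendsto 0).comp hgc).const_mul 2
    have h₂ : Tendsto (fun x => Φ x ⬝ᵥ (A (g x)).mulVec (Φ x)) (𝓝 0) (𝓝 0) :=
      (isLittleO_dotProduct_mulVec hA hΦc).isBigO.trans_tendsto hΦc
    simpa using ((h₁.sub h₂).sqrt).sub_const (Real.sqrt (2 * V 0))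
  have hquad : (fun x i => Φ x ⬝ᵥ
          (Matrix.of fun a b =>
            fderiv ℝ (fun s => A s a b) (g x) (Pi.single i 1)).mulVec (Φ x)) =o[𝓝 0] Φ := by
    refine isLittleO_pi.2 fun i => isLittleO_dotProduct_mulVec
      (M₀ := Matrix.of fun a b => fderiv ℝ (fun s => A s a b) 0 (Pi.single i 1)) ?_ hΦc
    refine tendsto_pi_nhds.2 fun a => tendsto_pi_nhds.2 fun b => ?_
    have h := ((hAc1 a b).continuous_fderiv one_ne_zero).clm_apply
      (continuous_const (y := (Pi.single i 1 : (Fin k ⊕ Fin l) → ℝ)))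
    exact (h.tendsto 0).comp hgc
  have hrem : (fun x => (Real.sqrt (2 * V (g x) - Φ x ⬝ᵥ (A (g x)).mulVec (Φ x))
      - Real.sqrt (2 * V 0)) • Φ x) =o[𝓝 0] Φ := by
    simpa using ((isLittleO_one_iff ℝ).2 hroot_tendsto).smul_isBigO (isBigO_refl Φ (𝓝 0))
  have hr : -(Real.sqrt (2 * V 0) / 2) ≠ 0 := by
    have : 0 < Real.sqrt (2 * V 0) := Real.sqrt_pos.2 (by linarith)
    linarith
  have hequiv : (fun x => gradV (g x)) ~[𝓝 0] fun x => (-(Real.sqrt (2 * V 0) / 2)) • Φ x := by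
    have h := (((isLittleO_clm_apply hDΦ φ).trans_isBigO hφΦ).add
      (hquad.const_smul_left (1 / 2 : ℝ))).sub (hrem.const_smul_left (1 / 2 : ℝ))
    refine IsLittleO.trans_isBigO (h.congr' ?_ EventuallyEq.rfl)
      ((isBigO_const_smul_right hr).2 (isBigO_refl Φ (𝓝 0)))
    refine eventually_of_mem hU fun x hx => ?_
    ext i
    simp only [hid2 x hx, Pi.add_apply, Pi.sub_apply, Pi.smul_apply, smul_eq_mul]
    ring
  have hΘ₁ : (fun x => gradV (g x)) =O[𝓝 0] φ :=
    (hequiv.isBigO.trans ((isBigO_const_smul_left hr).2 hΦφ))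
  have hΘ₂ : φ =O[𝓝 0] (fun x => gradV (g x)) :=
    hφΦ.trans (((isBigO_const_smul_right hr).2 (isBigO_refl Φ (𝓝 0))).trans hequiv.isBigO_symm)
  obtain ⟨c, hc, hc'⟩ := hΘ₁.exists_pos
  obtain ⟨d, hd, hd'⟩ := hΘ₂.exists_pos
  refine ⟨_, inter_mem hU (inter_mem hc'.bound hd'.bound), Set.inter_subset_left,
    d⁻¹, c + d⁻¹, inv_pos.2 hd, by linarith, fun x hx => ⟨?_, ?_⟩⟩
  · exact (inv_mul_le_iff₀ hd).2 hx.2.2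
  · refine le_trans hx.2.1 ?_
    gcongr
    linarith [inv_pos.2 hd]
end
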